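/- arXiv:0803.1332 — 10 statements merged into one kernel-verified Lean document; each statement's English description precedes it below -/
import Mathlib

section
/- Let g and d be positive integers and let E be a uniform admissible clutter in the standard model (a set of monotone functions f : Fin d → Fin g containing all constant functions). Let c : Fin g → Fin d be a size-g vertex cover, i.e., for every f ∈ E there exists i ∈ Fin d with c (f i) = i. Suppose j₀ is a position with c(j₀) = t, and suppose there exists a color l with t < l ≤ d such that c(j) = l for every position j > j₀ (when j₀ is the last position this condition amounts to t < d). Then the function c' defined by c'(j₀) = t + 1 and c'(j) = c(j) for j ≠ j₀ is again a vertex cover (hence a minimal one). -/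
/-- Lemma "RaiseTheEnd": for a uniform admissible clutter in the standard model
(a set `E` of monotone functions `Fin d → Fin g` containing all constant functions),
if `c : Fin g → Fin d` is a size-`g` vertex cover, `c j₀ = t`, and there is a color
`l > t` such that `c j = l` for every position `j > j₀`, then raising the value at
`j₀` from `t` to `t + 1` again yields a vertex cover (hence a minimal one). -/
theorem raise_the_end (g d : ℕ) (hg : 0 < g) (hd : 0 < d)
    (E : Set (Fin d → Fin g))
    (hmono : ∀ f ∈ E, Monotone f)
    (hconst : ∀ j : Fin g, (fun _ : Fin d => j) ∈ E)
    (c : Fin g → Fin d)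
    (hcover : ∀ f ∈ E, ∃ i : Fin d, c (f i) = i)
    (j₀ : Fin g) (t l : Fin d)
    (hct : c j₀ = t)
    (htl : t < l)
    (hl : ∀ j : Fin g, j₀ < j → c j = l) :
    ∀ f ∈ E, ∃ i : Fin d,
      (Function.update c j₀
        (⟨(t : ℕ) + 1, Nat.lt_of_le_of_lt (Nat.succ_le_of_lt htl) l.isLt⟩ : Fin d))
        (f i) = i := by
  intro f hf
  obtain ⟨i, hi⟩ := hcover f hf
  by_cases hij : f i = j₀
  · have hit : i = t := by rw [← hi, hij, hct]
    subst hit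
    set s : Fin d := ⟨(i : ℕ) + 1, Nat.lt_of_le_of_lt (Nat.succ_le_of_lt htl) l.isLt⟩
    have his : i ≤ s := Nat.le_succ (i : ℕ)
    have hsl : s ≤ l := Nat.succ_le_of_lt htl
    have hle : j₀ ≤ f s := hij ▸ hmono f hf his
    rcases hle.eq_or_lt with heq | hlt
    · exact ⟨s, by rw [← heq, Function.update_self]⟩
    · have hjl : j₀ < f l := hlt.trans_le (hmono f hf hsl)
      exact ⟨l, by rw [Function.update_of_ne hjl.ne', hl _ hjl]⟩
  · exact ⟨i, by rw [Function.update_of_ne hij, hi]⟩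
end

section
/- Let g and d be positive integers and let E be a uniform admissible clutter in the standard model (a set of monotone functions f : Fin d → Fin g containing all constant functions). Let c : Fin g → Fin d be a size-g vertex cover, i.e., for every f ∈ E there exists i ∈ Fin d with c (f i) = i. Suppose j₀ is a position with c(j₀) = t, and suppose there exists a color l with 1 ≤ l < t such that c(j) = l for every position j < j₀ (when j₀ is the first position this condition amounts to t > 1). Then the function c' defined by c'(j₀) = t − 1 and c'(j) = c(j) for j ≠ j₀ is again a vertex cover (hence a minimal one). -/
/-- Lemma "LowerTheFront": for a uniform admissible clutter in the standard model
(a set `E` of monotone functions `Fin d → Fin g` containing all constant functions),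
if `c : Fin g → Fin d` is a size-`g` vertex cover, `c j₀ = t`, and there is a color
`l < t` such that `c j = l` for every position `j < j₀` (when `j₀` is the first
position this just says `t` is not the first color), then lowering the value at
`j₀` from `t` to `t - 1` again yields a vertex cover (hence a minimal one). -/
theorem lower_the_front (g d : ℕ) (hg : 0 < g) (hd : 0 < d)
    (E : Set (Fin d → Fin g))
    (hmono : ∀ f ∈ E, Monotone f)
    (hconst : ∀ j : Fin g, (fun _ : Fin d => j) ∈ E)
    (c : Fin g → Fin d)
    (hcover : ∀ f ∈ E, ∃ i : Fin d, c (f i) = i)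
    (j₀ : Fin g) (t l : Fin d)
    (hct : c j₀ = t)
    (hlt : l < t)
    (hl : ∀ j : Fin g, j < j₀ → c j = l) :
    ∀ f ∈ E, ∃ i : Fin d,
      (Function.update c j₀
        (⟨(t : ℕ) - 1, Nat.lt_of_le_of_lt (Nat.sub_le _ _) t.isLt⟩ : Fin d))
        (f i) = i := by
  intro f hf
  obtain ⟨i, hi⟩ := hcover f hf
  by_cases hij : f i = j₀
  · obtain rfl : i = t := by rw [← hi, hij, hct]
    set s : Fin d := ⟨(i : ℕ) - 1, Nat.lt_of_le_of_lt (Nat.sub_le _ _) i.isLt⟩ with hs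
    have hsi : s ≤ i := Fin.le_def.mpr (Nat.sub_le _ _)
    have hls : l ≤ s := Fin.le_def.mpr (Nat.le_sub_one_of_lt hlt)
    rcases (hij ▸ hmono f hf hsi : f s ≤ j₀).eq_or_lt with h | h
    · exact ⟨s, by rw [h, Function.update_self]⟩
    · have hlj : f l < j₀ := (hmono f hf hls).trans_lt h
      exact ⟨l, by rw [Function.update_of_ne hlj.ne, hl _ hlj]⟩
  · exact ⟨i, by rw [Function.update_of_ne hij, hi]⟩
end

section
/- Let g and d be positive integers and let E be a uniform admissible clutter in the standard model (a set of monotone functions f : Fin d → Fin g containing all constant functions). Let C be a subset of (Fin g) × (Fin d), let j₀ ∈ Fin g be a position, and let a ≤ b be two colors in Fin d. If both C ∪ {(j₀, a)} and C ∪ {(j₀, b)} are vertex covers of the clutter, then C ∪ {(j₀, l)} is a vertex cover for every color l with a ≤ l ≤ b. -/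
/-- Lemma "Consecutive": for a uniform admissible clutter in the standard model,
if both `C ∪ {(j₀, a)}` and `C ∪ {(j₀, b)}` are vertex covers (with `a ≤ b`), then
`C ∪ {(j₀, l)}` is a vertex cover for every color `l` with `a ≤ l ≤ b`. -/
theorem consecutive (g d : ℕ) (hg : 0 < g) (hd : 0 < d)
    (E : Set (Fin d → Fin g))
    (hmono : ∀ f ∈ E, Monotone f)
    (hconst : ∀ j : Fin g, (fun _ : Fin d => j) ∈ E)
    (C : Set (Fin g × Fin d)) (j₀ : Fin g) (a b : Fin d) (hab : a ≤ b)
    (ha : ∀ f ∈ E, ∃ i : Fin d, (f i, i) ∈ C ∪ {(j₀, a)})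
    (hb : ∀ f ∈ E, ∃ i : Fin d, (f i, i) ∈ C ∪ {(j₀, b)}) :
    ∀ l : Fin d, a ≤ l → l ≤ b →
      ∀ f ∈ E, ∃ i : Fin d, (f i, i) ∈ C ∪ {(j₀, l)} := by
  intro l hal hlb f hf
  by_cases hC : ∃ i : Fin d, (f i, i) ∈ C
  · obtain ⟨i, hi⟩ := hC
    exact ⟨i, Or.inl hi⟩
  · have value_eq : ∀ c : Fin d, (∃ i : Fin d, (f i, i) ∈ C ∪ {(j₀, c)}) → f c = j₀ := by
      rintro c ⟨i, hi | hi⟩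
      · exact absurd ⟨i, hi⟩ hC
      · obtain ⟨hfi, rfl⟩ := Prod.mk.inj hi
        exact hfi
    have hfl : f l = j₀ := le_antisymm
      ((hmono f hf hlb).trans_eq (value_eq b (hb f hf)))
      ((value_eq a (ha f hf)).symm.trans_le (hmono f hf hal))
    exact ⟨l, Or.inr (Prod.ext hfl rfl)⟩
end

section
/- Let d be a positive integer, let K be a field, and let E be an unmixed uniform admissible clutter of height g = 2 in the standard model (a set of monotone functions f : Fin d → Fin 2 containing both constant functions, such that every minimal vertex cover has cardinality 2). Then the Alexander dual ideal I(𝒞)^∨ in MvPolynomial ((Fin 2) × (Fin d)) K, generated by the squarefree monomials ∏_{v ∈ C} X_v as C ranges over the minimal vertex covers, has linear quotients. -/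
/-- A subset `C` of the vertex set `(Fin g) × (Fin d)` is a vertex cover of the
clutter given by the edge set `E` if it meets every edge. -/
def IsCover {g d : ℕ} (E : Set (Fin d → Fin g)) (C : Finset (Fin g × Fin d)) : Prop :=
  ∀ f ∈ E, ∃ i : Fin d, (f i, i) ∈ C

/-- A minimal vertex cover: a vertex cover no proper subset of which is a vertex cover. -/
def IsMinCover {g d : ℕ} (E : Set (Fin d → Fin g)) (C : Finset (Fin g × Fin d)) : Prop :=
  IsCover E C ∧ ∀ C' ⊂ C, ¬ IsCover E C'

/-- The squarefree monomial `∏_{v ∈ C} X_v` associated to a set of vertices `C`. -/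
noncomputable def CoverMonomial (K : Type*) [CommRing K] {g d : ℕ}
    (C : Finset (Fin g × Fin d)) : MvPolynomial (Fin g × Fin d) K :=
  ∏ v ∈ C, MvPolynomial.X v

/-- A (finite) set `G` of monomials, generating a monomial ideal in a single degree,
has linear quotients if its elements can be enumerated as `u_1, …, u_r` so that for
each `i ≥ 1` the colon ideal `((u_1, …, u_i) : u_{i+1})` is generated by variables. -/
def HasLinearQuotients {V K : Type*} [CommRing K]
    (G : Set (MvPolynomial V K)) : Prop :=
  ∃ L : List (MvPolynomial V K), L.Nodup ∧ {u | u ∈ L} = G ∧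
    ∀ i : ℕ, ∀ hi : i < L.length, 0 < i →
      ∃ S : Set V,
        Submodule.colon (Ideal.span {u | u ∈ L.take i}) (Ideal.span {L.get ⟨i, hi⟩}) =
          Ideal.span (MvPolynomial.X '' S)

/-- A set of vertices is recovered from its squarefree monomial. -/
lemma coverMonomial_injective (K : Type*) [Field K] {g d : ℕ} :
    Function.Injective (CoverMonomial K : Finset (Fin g × Fin d) → _) := by
  classical
  have key (C : Finset (Fin g × Fin d)) (v : Fin g × Fin d) :
      v ∈ C ↔ MvPolynomial.eval (fun w => if w = v then (0 : K) else 1) (CoverMonomial K C) = 0 := by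
    simp [CoverMonomial]
  intro C D h
  ext v
  rw [key, key, h]

/-- A variable outside a set of variables can be cancelled from membership in the ideal
they generate. -/
lemma mem_span_X_image_of_mul_X {V K : Type*} [CommRing K] {S : Set V} {a : V} (ha : a ∉ S)
    {p : MvPolynomial V K}
    (h : p * MvPolynomial.X a ∈ Ideal.span (MvPolynomial.X '' S : Set (MvPolynomial V K))) :
    p ∈ Ideal.span (MvPolynomial.X '' S : Set (MvPolynomial V K)) := by
  classical
  rw [MvPolynomial.mem_ideal_span_X_image] at h ⊢
  intro m hm
  obtain ⟨i, hi, hne⟩ := h (m + Finsupp.single a 1) (by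
    rw [MvPolynomial.mem_support_iff, MvPolynomial.coeff_mul_X]
    exact MvPolynomial.mem_support_iff.1 hm)
  refine ⟨i, hi, ?_⟩
  have : a ≠ i := fun h => ha (h ▸ hi)
  simpa [Finsupp.single_apply, this] using hne

lemma colon_span_X_mul_X {V K : Type*} [CommRing K] {G : Set (MvPolynomial V K)} {S : Set V}
    {a b : V} (ha : a ∉ S) (hb : b ∉ S)
    (hG : ∀ u ∈ G, u ∈ Ideal.span (MvPolynomial.X '' S : Set (MvPolynomial V K)))
    (hS : ∀ s ∈ S, MvPolynomial.X s * (MvPolynomial.X a * MvPolynomial.X b) ∈ Ideal.span G) :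
    Submodule.colon (Ideal.span G)
        (Ideal.span {(MvPolynomial.X a * MvPolynomial.X b : MvPolynomial V K)}) =
      Ideal.span (MvPolynomial.X '' S) := by
  apply le_antisymm
  · intro p hp
    have h := Ideal.span_le.2 hG
      (Submodule.mem_colon.1 hp _ (Ideal.subset_span (Set.mem_singleton _)))
    rw [smul_eq_mul, ← mul_assoc] at h
    exact mem_span_X_image_of_mul_X ha (mem_span_X_image_of_mul_X hb h)
  · rw [Ideal.span_le]
    rintro _ ⟨s, hs, rfl⟩
    refine Submodule.mem_colon.2 fun q hq => ?_
    obtain ⟨r, rfl⟩ := Ideal.mem_span_singleton.1 hq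
    rw [smul_eq_mul, ← mul_assoc]
    exact Ideal.mul_mem_right _ _ (hS s hs)

/-- Two-element covers are preserved when the height-zero vertex moves down and the
height-one vertex moves up. -/
lemma IsCover.pair_mono {d : ℕ} {E : Set (Fin d → Fin 2)} (hmono : ∀ f ∈ E, Monotone f)
    {a a' b b' : Fin d} (h : IsCover E {(0, a), (1, b)}) (ha : a' ≤ a) (hb : b ≤ b') :
    IsCover E {(0, a'), (1, b')} := by
  intro f hf
  obtain ⟨i, hi⟩ := h f hf
  simp only [Finset.mem_insert, Finset.mem_singleton, Prod.mk.injEq] at hi ⊢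
  rcases hi with ⟨h0, rfl⟩ | ⟨h1, rfl⟩
  · have := hmono f hf ha
    exact ⟨a', Or.inl ⟨by omega, rfl⟩⟩
  · have := hmono f hf hb
    exact ⟨b', Or.inr ⟨by omega, rfl⟩⟩

lemma isMinCover_iff_pair {d : ℕ} {E : Set (Fin d → Fin 2)} (hmono : ∀ f ∈ E, Monotone f)
    (hconst : ∀ j : Fin 2, (fun _ : Fin d => j) ∈ E) {C : Finset (Fin 2 × Fin d)} :
    IsMinCover E C ↔ ∃ a b : Fin d, C = {(0, a), (1, b)} ∧ IsCover E {(0, a), (1, b)} := by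
  classical
  constructor
  · rintro ⟨hC, hmin⟩
    obtain ⟨a, ha, hamin⟩ := Set.exists_min_image {i : Fin d | (0, i) ∈ C} id (Set.toFinite _)
      (hC _ (hconst 0))
    obtain ⟨b, hb, hbmax⟩ := Set.exists_max_image {i : Fin d | (1, i) ∈ C} id (Set.toFinite _)
      (hC _ (hconst 1))
    have hsub : ({(0, a), (1, b)} : Finset (Fin 2 × Fin d)) ⊆ C := by
      simp only [Finset.insert_subset_iff, Finset.singleton_subset_iff]
      exact ⟨ha, hb⟩
    have hcov : IsCover E {(0, a), (1, b)} := by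
      intro f hf
      obtain ⟨i, hi⟩ := hC f hf
      simp only [Finset.mem_insert, Finset.mem_singleton, Prod.mk.injEq]
      by_cases h0 : f i = 0
      · have := hmono f hf (hamin i (by simpa [h0] using hi))
        simp only [id] at this
        exact ⟨a, Or.inl ⟨by omega, rfl⟩⟩
      · have h1 : f i = 1 := by omega
        have := hmono f hf (hbmax i (by simpa [h1] using hi))
        simp only [id] at this
        exact ⟨b, Or.inr ⟨by omega, rfl⟩⟩
    refine ⟨a, b, ?_, hcov⟩
    by_contra hne
    exact hmin _ (hsub.ssubset_of_ne (Ne.symm hne)) hcov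
  · rintro ⟨a, b, rfl, hcov⟩
    refine ⟨hcov, fun C' hC' hcov' => hC'.2 ?_⟩
    obtain ⟨i, hi⟩ := hcov' _ (hconst 0)
    obtain ⟨j, hj⟩ := hcov' _ (hconst 1)
    have hi' := hC'.1 hi
    have hj' := hC'.1 hj
    simp only [Finset.mem_insert, Finset.mem_singleton, Prod.mk.injEq] at hi' hj'
    obtain rfl : i = a := by simpa using hi'
    obtain rfl : j = b := by simpa using hj'
    simp only [Finset.insert_subset_iff, Finset.singleton_subset_iff]
    exact ⟨hi, hj⟩

lemma coverMonomial_pair (K : Type*) [CommRing K] {d : ℕ} (a b : Fin d) :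
    CoverMonomial K ({(0, a), (1, b)} : Finset (Fin 2 × Fin d)) =
      MvPolynomial.X (0, a) * MvPolynomial.X (1, b) := by
  rw [CoverMonomial, Finset.prod_pair (by simp)]

/-- The monomials of the two-element covers, enumerated along the lexicographic order
(reversed in the second coordinate), have linear quotients when the set of such covers is
closed under lowering the first and raising the second coordinate. -/
lemma hasLinearQuotients_of_pair_mono (K : Type*) [Field K] {d : ℕ} (P : Fin d → Fin d → Prop)
    (hP : ∀ a a' b b', P a b → a' ≤ a → b ≤ b' → P a' b') :
    HasLinearQuotients {u : MvPolynomial (Fin 2 × Fin d) K |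
      ∃ a b, P a b ∧ u = CoverMonomial K {(0, a), (1, b)}} := by
  classical
  let m : Fin d ×ₗ (Fin d)ᵒᵈ → MvPolynomial (Fin 2 × Fin d) K := fun q =>
    CoverMonomial K {(0, (ofLex q).1), (1, OrderDual.ofDual (ofLex q).2)}
  have hm : Function.Injective m := by
    intro q r h
    have h' := Finset.ext_iff.1 (coverMonomial_injective K h)
    have h0 := (h' (0, (ofLex q).1)).1 (by simp)
    have h1 := (h' (1, OrderDual.ofDual (ofLex q).2)).1 (by simp)
    simp only [Finset.mem_insert, Finset.mem_singleton, Prod.mk.injEq] at h0 h1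
    have h0 : (ofLex q).1 = (ofLex r).1 := by simpa using h0
    have h1 : (ofLex q).2 = (ofLex r).2 := by simpa using h1
    exact ofLex.injective (Prod.ext h0 h1)
  let l : List (Fin d ×ₗ (Fin d)ᵒᵈ) :=
    (Finset.univ.filter fun q : Fin d ×ₗ (Fin d)ᵒᵈ =>
      P (ofLex q).1 (OrderDual.ofDual (ofLex q).2)).sort (· ≤ ·)
  have hl (q) : q ∈ l ↔ P (ofLex q).1 (OrderDual.ofDual (ofLex q).2) := by
    simp [l]
  have hsorted : l.SortedLT := Finset.sortedLT_sort _
  refine ⟨l.map m, hsorted.nodup.map hm, ?_, ?_⟩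
  · ext u
    simp only [Set.mem_ofPred_eq, List.mem_map, hl]
    constructor
    · rintro ⟨q, hq, rfl⟩
      exact ⟨_, _, hq, rfl⟩
    · rintro ⟨a, b, hab, rfl⟩
      exact ⟨toLex (a, OrderDual.toDual b), hab, rfl⟩
  · intro i hi _
    have hi' : i < l.length := by simpa using hi
    have htake (u) : u ∈ (l.map m).take i ↔ ∃ q ∈ l, q < l[i] ∧ m q = u := by
      rw [← List.map_take, List.mem_map]
      refine exists_congr fun q => ?_
      rw [← and_assoc]
      refine and_congr_left fun _ => ?_
      constructor
      · intro hq
        obtain ⟨j, hj, rfl⟩ := List.mem_take_iff_getElem.1 hq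
        exact ⟨List.getElem_mem _, hsorted.getElem_lt_getElem_iff.2 (by omega)⟩
      · rintro ⟨hq, hlt⟩
        obtain ⟨j, hj, rfl⟩ := List.mem_iff_getElem.1 hq
        exact List.mem_take_iff_getElem.2
          ⟨j, by have := hsorted.getElem_lt_getElem_iff.1 hlt; omega, rfl⟩
    have hPi := (hl l[i]).1 (List.getElem_mem _)
    simp only [List.get_eq_getElem, List.getElem_map]
    generalize l[i] = r at htake hPi
    obtain ⟨⟨a, b⟩, rfl⟩ := toLex.surjective r
    obtain ⟨b, rfl⟩ := OrderDual.toDual.surjective b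
    change P a b at hPi
    have hmem {a' b' : Fin d} (hab : P a' b') (hlt : a' < a ∨ a' = a ∧ b < b') :
        (MvPolynomial.X (0, a') * MvPolynomial.X (1, b') : MvPolynomial (Fin 2 × Fin d) K) ∈
          Ideal.span {u | u ∈ (l.map m).take i} := by
      refine Ideal.subset_span ((htake _).2 ⟨toLex (a', OrderDual.toDual b'), (hl _).2 hab,
        Prod.Lex.toLex_lt_toLex.2 hlt, ?_⟩)
      exact coverMonomial_pair K a' b'
    refine ⟨{v | v.1 = 0 ∧ v.2 < a ∨ v.1 = 1 ∧ b < v.2}, ?_⟩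
    rw [show m (toLex (a, OrderDual.toDual b)) = _ from coverMonomial_pair K a b]
    refine colon_span_X_mul_X (by simp) (by simp) ?_ ?_
    · intro u hu
      obtain ⟨q, -, hlt, rfl⟩ := (htake u).1 hu
      rw [show m q = _ from coverMonomial_pair K _ _]
      rcases Prod.Lex.lt_iff.1 hlt with h | ⟨-, h⟩
      · exact Ideal.mul_mem_right _ _ (Ideal.subset_span ⟨_, Or.inl ⟨rfl, h⟩, rfl⟩)
      · exact Ideal.mul_mem_left _ _ (Ideal.subset_span
          ⟨_, Or.inr ⟨rfl, OrderDual.ofDual_lt_ofDual.2 h⟩, rfl⟩)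
    · rintro ⟨_, c⟩ (⟨rfl, hc⟩ | ⟨rfl, hc⟩)
      · have := Ideal.mul_mem_left _ (MvPolynomial.X (0, a))
          (hmem (hP _ _ _ _ hPi hc.le le_rfl) (Or.inl hc))
        rwa [mul_left_comm] at this
      · have := Ideal.mul_mem_left _ (MvPolynomial.X (1, b))
          (hmem (hP _ _ _ _ hPi le_rfl hc.le) (Or.inr ⟨rfl, hc⟩))
        convert this using 1
        ring


/-- Theorem (height 2): for an unmixed uniform admissible clutter of height `g = 2`
in the standard model, the Alexander dual ideal `I(𝒞)^∨`, generated by the squarefree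
monomials corresponding to the minimal vertex covers, has linear quotients. -/
theorem alexander_dual_linear_quotients_height_two (d : ℕ) (hd : 0 < d)
    (K : Type*) [Field K]
    (E : Set (Fin d → Fin 2))
    (hmono : ∀ f ∈ E, Monotone f)
    (hconst : ∀ j : Fin 2, (fun _ : Fin d => j) ∈ E)
    (hunmixed : ∀ C : Finset (Fin 2 × Fin d), IsMinCover E C → C.card = 2) :
    HasLinearQuotients {u : MvPolynomial (Fin 2 × Fin d) K |
      ∃ C : Finset (Fin 2 × Fin d), IsMinCover E C ∧ u = CoverMonomial K C} := by
  convert hasLinearQuotients_of_pair_mono K (fun a b => IsCover E {(0, a), (1, b)})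
    (fun _ _ _ _ h ha hb => h.pair_mono hmono ha hb) using 2
  ext u
  simp only [isMinCover_iff_pair hmono hconst]
  constructor
  · rintro ⟨_, ⟨a, b, rfl, h⟩, rfl⟩
    exact ⟨a, b, h, rfl⟩
  · rintro ⟨a, b, h, rfl⟩
    exact ⟨_, ⟨a, b, rfl, h⟩, rfl⟩
end

section
/- Let d be a positive integer, let K be a field, and let E be an unmixed uniform admissible clutter of height g = 3 in the standard model (a set of monotone functions f : Fin d → Fin 3 containing all three constant functions, such that every minimal vertex cover has cardinality 3). Then the Alexander dual ideal I(𝒞)^∨ in MvPolynomial ((Fin 3) × (Fin d)) K, generated by the squarefree monomials ∏_{v ∈ C} X_v as C ranges over the minimal vertex covers, has linear quotients. -/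
/-- The exponent vector of the squarefree monomial with support `C`. -/
noncomputable def squarefreeExponent {V : Type*} (C : Finset V) : V →₀ ℕ :=
  ∑ v ∈ C, Finsupp.single v 1

theorem squarefreeExponent_apply {V : Type*} [DecidableEq V] (C : Finset V) (w : V) :
    squarefreeExponent C w = if w ∈ C then 1 else 0 := by
  simp [squarefreeExponent, Finsupp.finsetSum_apply, Finsupp.single_apply]

theorem squarefreeExponent_injective {V : Type*} :
    Function.Injective (squarefreeExponent (V := V)) := by
  classical
  intro C D h
  ext w
  have hw := DFunLike.congr_fun h w
  rw [squarefreeExponent_apply, squarefreeExponent_apply] at hw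
  split_ifs at hw <;> simp_all

theorem prod_X_eq_monomial {V K : Type*} [CommRing K] (C : Finset V) :
    ∏ v ∈ C, (MvPolynomial.X v : MvPolynomial V K) =
      MvPolynomial.monomial (squarefreeExponent C) 1 := by
  rw [squarefreeExponent, MvPolynomial.monomial_sum_one]
  rfl

/-- If every set `D` of the family `𝓐` has a vertex `v ∉ C` such that some member of `𝓐` is
contained in `insert v C`, then the colon of the ideal of squarefree monomials supported on `𝓐`
by the monomial of `C` is generated by variables. -/
theorem exists_colon_eq_span_X {V K : Type*} [DecidableEq V] [CommRing K]
    (𝓐 : Set (Finset V)) (C : Finset V)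
    (h : ∀ D ∈ 𝓐, ∃ v ∈ D, v ∉ C ∧ ∃ B ∈ 𝓐, B ⊆ insert v C) :
    ∃ S : Set V,
      Submodule.colon
          (Ideal.span ((fun D : Finset V ↦ ∏ v ∈ D, (MvPolynomial.X v : MvPolynomial V K)) '' 𝓐))
          (Ideal.span {∏ v ∈ C, (MvPolynomial.X v : MvPolynomial V K)}) =
        Ideal.span (MvPolynomial.X '' S) := by
  refine ⟨{v | v ∉ C ∧ ∃ B ∈ 𝓐, B ⊆ insert v C}, ?_⟩
  apply le_antisymm
  · intro p hp
    have hpC : p * ∏ v ∈ C, (MvPolynomial.X v : MvPolynomial V K) ∈ Ideal.span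
        ((fun D : Finset V ↦ ∏ v ∈ D, (MvPolynomial.X v : MvPolynomial V K)) '' 𝓐) := by
      simpa using Submodule.mem_colon.mp hp _ (Ideal.subset_span rfl)
    have himage : (fun D : Finset V ↦ ∏ v ∈ D, (MvPolynomial.X v : MvPolynomial V K)) '' 𝓐 =
        (fun s ↦ MvPolynomial.monomial s (1 : K)) '' (squarefreeExponent '' 𝓐) := by
      rw [Set.image_image]
      simp only [prod_X_eq_monomial]
    rw [himage, prod_X_eq_monomial, MvPolynomial.mem_ideal_span_monomial_image] at hpC
    rw [MvPolynomial.mem_ideal_span_X_image]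
    intro m hm
    obtain ⟨_, ⟨D, hD, rfl⟩, hle⟩ := hpC (m + squarefreeExponent C) (by
      rw [MvPolynomial.mem_support_iff, MvPolynomial.coeff_mul_monomial, mul_one]
      exact MvPolynomial.mem_support_iff.mp hm)
    obtain ⟨v, hvD, hvC, hB⟩ := h D hD
    refine ⟨v, ⟨hvC, hB⟩, ?_⟩
    have hv := hle v
    rw [Finsupp.add_apply, squarefreeExponent_apply, squarefreeExponent_apply,
      if_pos hvD, if_neg hvC] at hv
    omega
  · rw [Ideal.span_le]
    rintro _ ⟨v, ⟨hvC, B, hB, hBC⟩, rfl⟩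
    rw [SetLike.mem_coe, Submodule.mem_colon]
    intro q hq
    obtain ⟨r, rfl⟩ := Ideal.mem_span_singleton.mp hq
    rw [smul_eq_mul, ← mul_assoc, ← Finset.prod_insert hvC]
    exact Ideal.mul_mem_right _ _ (Ideal.mem_of_dvd _ (Finset.prod_dvd_prod_of_subset _ _ _ hBC)
      (Ideal.subset_span ⟨B, hB, rfl⟩))

/-- An enumeration of finite sets with the exchange property gives linear quotients for the
associated squarefree monomials. -/
theorem hasLinearQuotients_of_exchange {V K : Type*} [DecidableEq V] [CommRing K] [Nontrivial K]
    (L : List (Finset V)) (hL : L.Nodup)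
    (h : ∀ i (hi : i < L.length), ∀ D ∈ L.take i,
      ∃ v ∈ D, v ∉ L[i] ∧ ∃ B ∈ L.take i, B ⊆ insert v L[i]) :
    HasLinearQuotients
      ((fun C : Finset V ↦ ∏ v ∈ C, (MvPolynomial.X v : MvPolynomial V K)) '' {C | C ∈ L}) := by
  refine ⟨L.map fun C ↦ ∏ v ∈ C, MvPolynomial.X v, hL.map ?_, ?_, ?_⟩
  · intro C D hCD
    simp only [prod_X_eq_monomial] at hCD
    exact squarefreeExponent_injective (MvPolynomial.monomial_left_injective one_ne_zero hCD)
  · ext u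
    simp
  · intro i hi _
    rw [List.length_map] at hi
    obtain ⟨S, hS⟩ := exists_colon_eq_span_X (K := K) {D | D ∈ L.take i} L[i] (h i hi)
    refine ⟨S, ?_⟩
    rw [← hS]
    congr 2
    · congr 1
      ext u
      simp [← List.map_take]
    · simp

/-- The transversal of the three rows with columns `a`, `b`, `c`, indexed by the triple
`(a, c, b)`; the lexicographic order on these indices, with `c` reversed, is a linear quotient
order. -/
def rowTransversal {d : ℕ} (t : Fin d ×ₗ (Fin d)ᵒᵈ ×ₗ Fin d) : Finset (Fin 3 × Fin d) :=
  {(0, (ofLex t).1), (1, (ofLex (ofLex t).2).2), (2, OrderDual.ofDual (ofLex (ofLex t).2).1)}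

theorem mem_rowTransversal {d : ℕ} {a b c : Fin d} {v : Fin 3 × Fin d} :
    v ∈ rowTransversal (toLex (a, toLex (OrderDual.toDual c, b))) ↔
      v = (0, a) ∨ v = (1, b) ∨ v = (2, c) := by
  simp [rowTransversal]

theorem rowTransversal_injective {d : ℕ} : Function.Injective (rowTransversal (d := d)) := by
  rintro ⟨a, c, b⟩ ⟨a', c', b'⟩ h
  have h0 : ((0 : Fin 3), a) ∈ rowTransversal (toLex (a', toLex (c', b'))) :=
    h ▸ mem_rowTransversal.mpr (Or.inl rfl)
  have h1 : ((1 : Fin 3), b) ∈ rowTransversal (toLex (a', toLex (c', b'))) :=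
    h ▸ mem_rowTransversal.mpr (Or.inr (Or.inl rfl))
  have h2 : ((2 : Fin 3), OrderDual.ofDual c) ∈ rowTransversal (toLex (a', toLex (c', b'))) :=
    h ▸ mem_rowTransversal.mpr (Or.inr (Or.inr rfl))
  obtain rfl : a = a' := by simpa [rowTransversal] using h0
  obtain rfl : b = b' := by simpa [rowTransversal] using h1
  obtain rfl : c = c' := by simpa [rowTransversal] using h2
  rfl

theorem isCover_rowTransversal {d : ℕ} {E : Set (Fin d → Fin 3)} {a b c : Fin d} :
    IsCover E (rowTransversal (toLex (a, toLex (OrderDual.toDual c, b)))) ↔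
      ∀ f ∈ E, f a = 0 ∨ f b = 1 ∨ f c = 2 := by
  refine forall₂_congr fun f _ ↦ ?_
  simp only [mem_rowTransversal, Prod.mk.injEq]
  constructor
  · rintro ⟨i, ⟨h, rfl⟩ | ⟨h, rfl⟩ | ⟨h, rfl⟩⟩ <;> simp [h]
  · rintro (h | h | h)
    exacts [⟨a, by simp [h]⟩, ⟨b, by simp [h]⟩, ⟨c, by simp [h]⟩]

theorem card_rowTransversal {d : ℕ} (t : Fin d ×ₗ (Fin d)ᵒᵈ ×ₗ Fin d) :
    (rowTransversal t).card = 3 := by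
  simp [rowTransversal]

/-- A cover of a clutter containing the constant functions contains a row transversal. -/
theorem IsCover.exists_rowTransversal_subset {d : ℕ} {E : Set (Fin d → Fin 3)}
    (hconst : ∀ j : Fin 3, (fun _ : Fin d ↦ j) ∈ E) {C : Finset (Fin 3 × Fin d)}
    (hC : IsCover E C) : ∃ t, rowTransversal t ⊆ C := by
  obtain ⟨a, ha⟩ := hC _ (hconst 0)
  obtain ⟨b, hb⟩ := hC _ (hconst 1)
  obtain ⟨c, hc⟩ := hC _ (hconst 2)
  refine ⟨toLex (a, toLex (OrderDual.toDual c, b)), fun v hv ↦ ?_⟩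
  rcases mem_rowTransversal.mp hv with rfl | rfl | rfl <;> assumption

theorem isMinCover_iff_rowTransversal {d : ℕ} {E : Set (Fin d → Fin 3)}
    (hconst : ∀ j : Fin 3, (fun _ : Fin d ↦ j) ∈ E)
    (hunmixed : ∀ C : Finset (Fin 3 × Fin d), IsMinCover E C → C.card = 3)
    {C : Finset (Fin 3 × Fin d)} :
    IsMinCover E C ↔ ∃ t, IsCover E (rowTransversal t) ∧ rowTransversal t = C := by
  constructor
  · intro hC
    obtain ⟨t, ht⟩ := hC.1.exists_rowTransversal_subset hconst
    have heq := Finset.eq_of_subset_of_card_le ht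
      (by rw [hunmixed C hC, card_rowTransversal])
    exact ⟨t, heq ▸ hC.1, heq⟩
  · rintro ⟨t, ht, rfl⟩
    refine ⟨ht, fun C' hss hC' ↦ ?_⟩
    obtain ⟨s, hs⟩ := hC'.exists_rowTransversal_subset hconst
    have h1 := Finset.card_le_card hs
    have h2 := Finset.card_lt_card hss
    rw [card_rowTransversal] at h1 h2
    omega

/-- The exchange property of the covering row transversals in the lexicographic order. -/
theorem exists_exchange_rowTransversal {d : ℕ} {E : Set (Fin d → Fin 3)}
    (hmono : ∀ f ∈ E, Monotone f) {s t : Fin d ×ₗ (Fin d)ᵒᵈ ×ₗ Fin d}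
    (hs : IsCover E (rowTransversal s)) (ht : IsCover E (rowTransversal t)) (hst : s < t) :
    ∃ v ∈ rowTransversal s, v ∉ rowTransversal t ∧ ∃ r < t, IsCover E (rowTransversal r) ∧
      rowTransversal r ⊆ insert v (rowTransversal t) := by
  obtain ⟨a', c', b'⟩ := s
  obtain ⟨a, c, b⟩ := t
  change toLex (a', toLex (c', b')) < toLex (a, toLex (c, b)) at hst
  rw [Prod.Lex.toLex_lt_toLex, Prod.Lex.toLex_lt_toLex] at hst
  have hcov := isCover_rowTransversal.mp ht
  rcases hst with haa | ⟨rfl, hcc | ⟨rfl, hbb⟩⟩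
  · refine ⟨(0, a'), mem_rowTransversal.mpr (Or.inl rfl), ?_,
      toLex (a', toLex (c, b)), ?_, ?_, ?_⟩
    · exact fun h ↦ haa.ne (by simpa [Prod.ext_iff] using mem_rowTransversal.mp h)
    · exact Prod.Lex.toLex_lt_toLex.mpr (Or.inl haa)
    · refine isCover_rowTransversal.mpr fun f hf ↦ (hcov f hf).imp_left fun h0 ↦ ?_
      exact le_antisymm (h0 ▸ hmono f hf haa.le) (Fin.zero_le _)
    · intro v hv
      simp only [rowTransversal, Finset.mem_insert, Finset.mem_singleton] at hv ⊢
      tauto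
  · refine ⟨(2, OrderDual.ofDual c'), mem_rowTransversal.mpr (Or.inr (Or.inr rfl)), ?_,
      toLex (a', toLex (c', b)), ?_, ?_, ?_⟩
    · intro h
      have hc : OrderDual.ofDual c' = OrderDual.ofDual c := by
        rcases mem_rowTransversal.mp h with h | h | h
        exacts [absurd (congrArg Prod.fst h) (by decide : (2 : Fin 3) ≠ 0),
          absurd (congrArg Prod.fst h) (by decide : (2 : Fin 3) ≠ 1), congrArg Prod.snd h]
      exact hcc.ne hc
    · exact Prod.Lex.toLex_lt_toLex.mpr
        (Or.inr ⟨rfl, Prod.Lex.toLex_lt_toLex.mpr (Or.inl hcc)⟩)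
    · refine isCover_rowTransversal.mpr fun f hf ↦
        (hcov f hf).imp_right (Or.imp_right fun h2 ↦ ?_)
      exact le_antisymm (Fin.le_last _) (h2 ▸ hmono f hf hcc.le)
    · intro v hv
      simp only [rowTransversal, Finset.mem_insert, Finset.mem_singleton] at hv ⊢
      tauto
  · refine ⟨(1, b'), mem_rowTransversal.mpr (Or.inr (Or.inl rfl)), ?_,
      toLex (a', toLex (c', b')), ?_, hs, ?_⟩
    · exact fun h ↦ hbb.ne (by simpa [Prod.ext_iff] using mem_rowTransversal.mp h)
    · exact Prod.Lex.toLex_lt_toLex.mpr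
        (Or.inr ⟨rfl, Prod.Lex.toLex_lt_toLex.mpr (Or.inr ⟨rfl, hbb⟩)⟩)
    · intro v hv
      simp only [rowTransversal, Finset.mem_insert, Finset.mem_singleton] at hv ⊢
      tauto

/-- Theorem (height 3): for an unmixed uniform admissible clutter of height `g = 3`
in the standard model, the Alexander dual ideal `I(𝒞)^∨`, generated by the squarefree
monomials corresponding to the minimal vertex covers, has linear quotients. -/
theorem alexander_dual_linear_quotients_height_three (d : ℕ) (hd : 0 < d)
    (K : Type*) [Field K]
    (E : Set (Fin d → Fin 3))
    (hmono : ∀ f ∈ E, Monotone f)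
    (hconst : ∀ j : Fin 3, (fun _ : Fin d => j) ∈ E)
    (hunmixed : ∀ C : Finset (Fin 3 × Fin d), IsMinCover E C → C.card = 3) :
    HasLinearQuotients {u : MvPolynomial (Fin 3 × Fin d) K |
      ∃ C : Finset (Fin 3 × Fin d), IsMinCover E C ∧ u = CoverMonomial K C} := by
  classical
  let _ : Fintype (Fin d ×ₗ (Fin d)ᵒᵈ ×ₗ Fin d) :=
    inferInstanceAs (Fintype (Fin d × Fin d × Fin d))
  let T : Finset (Fin d ×ₗ (Fin d)ᵒᵈ ×ₗ Fin d) := {t | IsCover E (rowTransversal t)}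
  have hT : ∀ t, t ∈ T.sort ↔ IsCover E (rowTransversal t) := by simp [T]
  have hsorted : (T.sort).SortedLT := T.sortedLT_sort
  have hset : {u : MvPolynomial (Fin 3 × Fin d) K |
      ∃ C : Finset (Fin 3 × Fin d), IsMinCover E C ∧ u = CoverMonomial K C} =
      (fun C ↦ ∏ v ∈ C, MvPolynomial.X v) '' {C | C ∈ (T.sort).map rowTransversal} := by
    ext u
    simp only [Set.mem_ofPred_eq, Set.mem_image, List.mem_map, hT,
      isMinCover_iff_rowTransversal hconst hunmixed, CoverMonomial, eq_comm (a := u)]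
  rw [hset]
  refine hasLinearQuotients_of_exchange _ (hsorted.nodup.map rowTransversal_injective) ?_
  intro i hi D hD
  rw [List.length_map] at hi
  rw [← List.map_take, List.mem_map] at hD
  obtain ⟨s, hs, rfl⟩ := hD
  have htake : ∀ r, r ∈ (T.sort).take i ↔ r ∈ T.sort ∧ r < (T.sort)[i] := by
    intro r
    rw [List.mem_take_iff_getElem]
    constructor
    · rintro ⟨j, hj, rfl⟩
      exact ⟨List.getElem_mem _, hsorted.getElem_lt_getElem_iff.mpr (by omega)⟩
    · rintro ⟨hr, hlt⟩
      obtain ⟨j, hj, rfl⟩ := List.mem_iff_getElem.mp hr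
      exact ⟨j, lt_min (hsorted.getElem_lt_getElem_iff.mp hlt) hj, rfl⟩
  obtain ⟨hsT, hlt⟩ := (htake s).mp hs
  obtain ⟨v, hvs, hvt, r, hrt, hr, hsub⟩ := exists_exchange_rowTransversal hmono
    ((hT s).mp hsT) ((hT _).mp (List.getElem_mem hi)) hlt
  rw [List.getElem_map]
  refine ⟨v, hvs, hvt, rowTransversal r, ?_, hsub⟩
  rw [← List.map_take]
  exact List.mem_map_of_mem ((htake r).mpr ⟨(hT r).mpr hr, hrt⟩)
end

section
/- Let d be a positive integer and let E be a uniform admissible clutter of height g = 4 in the standard model (a set of monotone functions f : Fin d → Fin 4 containing all constant functions). Identify size-4 vertex covers with 4-tuples of colors. Suppose (a, b, t, e), (a, s, t, e), (a, r, t, e), (a, b, c, e) and (a, s, p, e) are all vertex covers, where c > t and p > t, and suppose that neither (a, s, c, e) nor (a, r, p, e) is a vertex cover. Then (a, r, c, e) is not a vertex cover. -/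
/-- The size-4 vertex cover `{x_1^a, x_2^b, x_3^c, x_4^e}` associated to a 4-tuple
`(a, b, c, e)` of colors. -/
def TupleCover {d : ℕ} (a b c e : Fin d) : Finset (Fin 4 × Fin d) :=
  {((0 : Fin 4), a), ((1 : Fin 4), b), ((2 : Fin 4), c), ((3 : Fin 4), e)}

theorem isCover_tupleCover_iff {d : ℕ} {E : Set (Fin d → Fin 4)} {a b c e : Fin d} :
    IsCover E (TupleCover a b c e) ↔
      ∀ f ∈ E, f a = 0 ∨ f b = 1 ∨ f c = 2 ∨ f e = 3 := by
  simp [IsCover, TupleCover, exists_or]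

/-- (Transitivity step, Case 1 of Theorem 5.4.)  For a uniform admissible clutter of
height 4 in the standard model: if `(a, b, t, e)`, `(a, s, t, e)`, `(a, r, t, e)`,
`(a, b, c, e)` and `(a, s, p, e)` are all vertex covers, with `c > t` and `p > t`,
and neither `(a, s, c, e)` nor `(a, r, p, e)` is a vertex cover, then `(a, r, c, e)`
is not a vertex cover. -/
theorem transitivity_case_one (d : ℕ) (hd : 0 < d)
    (E : Set (Fin d → Fin 4))
    (hmono : ∀ f ∈ E, Monotone f)
    (hconst : ∀ j : Fin 4, (fun _ : Fin d => j) ∈ E)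
    (a b s r t c p e : Fin d)
    (h1 : IsCover E (TupleCover a b t e))
    (h2 : IsCover E (TupleCover a s t e))
    (h3 : IsCover E (TupleCover a r t e))
    (h4 : IsCover E (TupleCover a b c e))
    (h5 : IsCover E (TupleCover a s p e))
    (htc : t < c) (htp : t < p)
    (h6 : ¬ IsCover E (TupleCover a s c e))
    (h7 : ¬ IsCover E (TupleCover a r p e)) :
    ¬ IsCover E (TupleCover a r c e) := by
  intro h
  simp only [isCover_tupleCover_iff] at *
  push Not at h6 h7
  obtain ⟨f, hf, hfa, hfs, hfc, hfe⟩ := h6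
  obtain ⟨g, hg, hga, hgr, hgp, hge⟩ := h7
  have hft : f t = 2 := by grind
  have hfp : f p = 2 := by grind
  have hfc' : 2 ≤ f c := hft ▸ hmono f hf htc.le
  have hpc : p < c := (hmono f hf).reflect_lt (hfp ▸ lt_of_le_of_ne hfc' hfc.symm)
  have hgt : g t = 2 := by grind
  have hgc : g c = 2 := by grind
  have hgp' : 2 ≤ g p := hgt ▸ hmono g hg htp.le
  have hcp : c < p := (hmono g hg).reflect_lt (hgc ▸ lt_of_le_of_ne hgp' hgp.symm)
  exact hpc.asymm hcp
end

section
/- Let g ≥ 4 be an integer and let 𝒞_g be the uniform admissible clutter in the standard model with height g and d = 5 color classes whose edge set consists of the g constant functions together with the four monotone functions (written as 5-tuples of values in {1, ..., g}): (1,2,3,3,4), (1,1,2,2,3), (1,1,3,3,3), and (1,2,2,2,4). Then 𝒞_g is unmixed: every minimal vertex cover of 𝒞_g has cardinality exactly g. -/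
/-- The counterexample clutter `𝒞_g` with height `g ≥ 4` and `d = 5` color classes:
its edges are the `g` constant functions together with the four monotone functions
(1,2,3,3,4), (1,1,2,2,3), (1,1,3,3,3), (1,2,2,2,4) (written here 0-indexed, their
values regarded in `Fin g` via `Fin.castLE`). -/
def ClutterCg (g : ℕ) (hg : 4 ≤ g) : Set (Fin 5 → Fin g) :=
  {f | (∃ j : Fin g, f = fun _ => j) ∨
    f = Fin.castLE hg ∘ ![0, 1, 2, 2, 3] ∨
    f = Fin.castLE hg ∘ ![0, 0, 1, 1, 2] ∨
    f = Fin.castLE hg ∘ ![0, 0, 2, 2, 2] ∨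
    f = Fin.castLE hg ∘ ![0, 1, 1, 1, 3]}

/-- The non-constant edges of `𝒞_g`, with values in `Fin 4`. -/
def nonconstEdges : List (Fin 5 → Fin 4) :=
  [![0, 1, 2, 2, 3], ![0, 0, 1, 1, 2], ![0, 0, 2, 2, 2], ![0, 1, 1, 1, 3]]

theorem mem_clutterCg_iff {g : ℕ} (hg : 4 ≤ g) (f : Fin 5 → Fin g) :
    f ∈ ClutterCg g hg ↔
      (∃ j : Fin g, f = fun _ => j) ∨ ∃ u ∈ nonconstEdges, f = Fin.castLE hg ∘ u := by
  simp [ClutterCg, nonconstEdges]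

/-- Every vertex of a minimal cover is the only vertex of the cover on some edge. -/
theorem IsMinCover.exists_private_edge {g d : ℕ} {E : Set (Fin d → Fin g)}
    {C : Finset (Fin g × Fin d)} (hC : IsMinCover E C) {j : Fin g} {a : Fin d}
    (h : (j, a) ∈ C) : ∃ f ∈ E, f a = j ∧ ∀ i, (f i, i) ∈ C → i = a := by
  have hnot := hC.2 _ (Finset.erase_ssubset h)
  simp only [IsCover, not_forall, not_exists, Finset.mem_erase, not_and', ne_eq, not_not] at hnot
  obtain ⟨f, hf, hpriv⟩ := hnot
  have honly : ∀ i, (f i, i) ∈ C → i = a := fun i hi => (Prod.ext_iff.1 (hpriv i hi)).2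
  obtain ⟨i, hi⟩ := hC.1 f hf
  obtain rfl := honly i hi
  exact ⟨f, hf, (Prod.ext_iff.1 (hpriv i hi)).1, honly⟩

set_option maxRecDepth 100000 in
/-- Two edges meeting a row in different single vertices `a`, `b` admit an edge inside their
union that avoids both vertices. -/
theorem nonconstEdges_exchange :
    ∀ u ∈ nonconstEdges, ∀ w ∈ nonconstEdges, ∀ a b : Fin 5,
      u a = w b → u b ≠ u a → w a ≠ w b →
      ∃ x ∈ nonconstEdges, ∀ i, (x i = u i ∧ i ≠ a) ∨ (x i = w i ∧ i ≠ b) := by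
  decide

/-- A minimal cover of `𝒞_g` has at most one vertex on each matching edge. -/
theorem IsMinCover.clutterCg_row_unique {g : ℕ} {hg : 4 ≤ g} {C : Finset (Fin g × Fin 5)}
    (hC : IsMinCover (ClutterCg g hg) C) {j : Fin g} {a b : Fin 5}
    (ha : (j, a) ∈ C) (hb : (j, b) ∈ C) : a = b := by
  obtain ⟨f, hf, hfa, hf_only⟩ := hC.exists_private_edge ha
  obtain ⟨f', hf', hfb, hf'_only⟩ := hC.exists_private_edge hb
  by_contra hab
  have hfba : f b ≠ j := fun h => hab (hf_only b (h ▸ hb)).symm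
  have hfab : f' a ≠ j := fun h => hab (hf'_only a (h ▸ ha))
  rcases (mem_clutterCg_iff hg f).1 hf with ⟨k, rfl⟩ | ⟨u, hu, rfl⟩
  · exact hfba hfa
  rcases (mem_clutterCg_iff hg f').1 hf' with ⟨k, rfl⟩ | ⟨w, hw, rfl⟩
  · exact hfab hfb
  simp only [Function.comp_apply] at *
  obtain ⟨x, hx, hx_avoid⟩ := nonconstEdges_exchange u hu w hw a b
    (Fin.castLE_injective hg (hfa.trans hfb.symm))
    (fun h => hfba (h ▸ hfa)) (fun h => hfab (h ▸ hfb))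
  obtain ⟨i, hi⟩ := hC.1 _ ((mem_clutterCg_iff hg _).2 (Or.inr ⟨x, hx, rfl⟩))
  rw [Function.comp_apply] at hi
  rcases hx_avoid i with ⟨h, hne⟩ | ⟨h, hne⟩
  · exact hne (hf_only i (h ▸ hi))
  · exact hne (hf'_only i (h ▸ hi))

/-- The clutter `𝒞_g` is unmixed: every minimal vertex cover has cardinality
exactly `g`. -/
theorem clutterCg_unmixed (g : ℕ) (hg : 4 ≤ g) :
    ∀ C : Finset (Fin g × Fin 5), IsMinCover (ClutterCg g hg) C → C.card = g := by
  intro C hC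
  have hinj : Set.InjOn Prod.fst (C : Set (Fin g × Fin 5)) := by
    rintro ⟨j, a⟩ ha ⟨k, b⟩ hb rfl
    exact Prod.ext rfl (hC.clutterCg_row_unique ha hb)
  have himage : C.image Prod.fst = Finset.univ := by
    refine Finset.eq_univ_of_forall fun j => ?_
    obtain ⟨i, hi⟩ := hC.1 (fun _ => j) (Or.inl ⟨j, rfl⟩)
    exact Finset.mem_image_of_mem Prod.fst hi
  rw [← Finset.card_image_of_injOn hinj, himage, Finset.card_univ, Fintype.card_fin]
end

section
/- Let g ≥ 4 be an integer and let 𝒞_g be the uniform admissible clutter in the standard model with height g and d = 5 color classes whose edge set consists of the g constant functions together with the four monotone functions (written as 5-tuples of values in {1, ..., g}): (1,2,3,3,4), (1,1,2,2,3), (1,1,3,3,3), and (1,2,2,2,4). If C is a minimal vertex cover of 𝒞_g, then the set {(j, i) ∈ C : j ≤ 4}, regarded (via the obvious identification of the first four rows) as a subset of (Fin 4) × (Fin 5), is a minimal vertex cover of the clutter 𝒞₄ defined in the same way with g = 4. -/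
theorem castLE_comp_mem_clutterCg {g : ℕ} (hg : 4 ≤ g) {f : Fin 5 → Fin 4}
    (hf : f ∈ ClutterCg 4 (le_refl 4)) : Fin.castLE hg ∘ f ∈ ClutterCg g hg := by
  rcases hf with ⟨j, rfl⟩ | rfl | rfl | rfl | rfl
  · exact Or.inl ⟨Fin.castLE hg j, rfl⟩
  · exact Or.inr (Or.inl rfl)
  · exact Or.inr (Or.inr (Or.inl rfl))
  · exact Or.inr (Or.inr (Or.inr (Or.inl rfl)))
  · exact Or.inr (Or.inr (Or.inr (Or.inr rfl)))

/-- Every edge of `𝒞_g` is either an edge of `𝒞₄` or a matching edge in a row beyond the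
fourth. -/
theorem exists_eq_castLE_comp_or_const_of_mem_clutterCg {g : ℕ} {hg : 4 ≤ g}
    {f : Fin 5 → Fin g} (hf : f ∈ ClutterCg g hg) :
    (∃ f' ∈ ClutterCg 4 (le_refl 4), f = Fin.castLE hg ∘ f') ∨
      ∃ j : Fin g, 4 ≤ (j : ℕ) ∧ f = fun _ => j := by
  rcases hf with ⟨j, rfl⟩ | rfl | rfl | rfl | rfl
  · by_cases hj : (j : ℕ) < 4
    · exact Or.inl ⟨fun _ => ⟨j, hj⟩, Or.inl ⟨_, rfl⟩, rfl⟩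
    · exact Or.inr ⟨j, not_lt.mp hj, rfl⟩
  · exact Or.inl ⟨_, Or.inr (Or.inl rfl), rfl⟩
  · exact Or.inl ⟨_, Or.inr (Or.inr (Or.inl rfl)), rfl⟩
  · exact Or.inl ⟨_, Or.inr (Or.inr (Or.inr (Or.inl rfl))), rfl⟩
  · exact Or.inl ⟨_, Or.inr (Or.inr (Or.inr (Or.inr rfl))), rfl⟩

/-- If `C` is a minimal vertex cover of `𝒞_g` (with `g ≥ 4`), then its restriction
to the first four rows — the set `{(j, i) ∈ C : j ≤ 4}`, regarded as a subset of
`(Fin 4) × (Fin 5)` — is a minimal vertex cover of the clutter `𝒞₄`. -/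
theorem restriction_is_minimal_cover (g : ℕ) (hg : 4 ≤ g)
    (C : Finset (Fin g × Fin 5))
    (hC : IsMinCover (ClutterCg g hg) C) :
    IsMinCover (ClutterCg 4 (le_refl 4))
      (Finset.univ.filter (fun v : Fin 4 × Fin 5 => (Fin.castLE hg v.1, v.2) ∈ C)) := by
  classical
  refine ⟨fun f hf => ?_, fun D hD hDcover => ?_⟩
  · obtain ⟨i, hi⟩ := hC.1 _ (castLE_comp_mem_clutterCg hg hf)
    exact ⟨i, by simpa using hi⟩
  have hsub := hD.subset
  obtain ⟨⟨j, i⟩, hv, hvD⟩ := Finset.exists_of_ssubset hD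
  -- Replace the first four rows of `C` by `D`.
  refine hC.2 (C.filter fun v => ∀ h : (v.1 : ℕ) < 4, (⟨v.1, h⟩, v.2) ∈ D) ?_ ?_
  · exact Finset.filter_ssubset.mpr
      ⟨(Fin.castLE hg j, i), (Finset.mem_filter.mp hv).2, fun h => hvD (h j.isLt)⟩
  · intro f hf
    rcases exists_eq_castLE_comp_or_const_of_mem_clutterCg hf with ⟨f', hf', rfl⟩ | ⟨k, hk, rfl⟩
    · obtain ⟨i, hi⟩ := hDcover f' hf'
      exact ⟨i, Finset.mem_filter.mpr ⟨(Finset.mem_filter.mp (hsub hi)).2, fun _ => hi⟩⟩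
    · obtain ⟨i, hi⟩ := hC.1 _ hf
      exact ⟨i, Finset.mem_filter.mpr ⟨hi, fun h => absurd h (not_lt.mpr hk)⟩⟩
end

section
/- Let V be a finite set, let E be a family of subsets of V (the edges of a clutter), and let d be a positive integer. Suppose x, y : Fin d → V are injective maps with disjoint images whose union is all of V, that the sets e₁ = {x 1, ..., x d} and e₂ = {y 1, ..., y d} are edges (members of E), and that every edge e ∈ E contains exactly one of the two vertices x i, y i for each i ∈ Fin d. Fix an index k, and assume that for every i ∈ Fin d the two-element set {x k, y i} is a vertex cover, i.e., meets every edge of E. Then y k is a free vertex of the clutter: the only edge of E containing y k is e₂. -/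
/-- Key step in Theorem 3.6 (free vertex): let `E` be a family of subsets (edges) of a
finite vertex set `V`, and let `x, y : Fin d → V` be injective with disjoint images
whose union is all of `V`.  Suppose `e₁ = range x` and `e₂ = range y` are edges, and
every edge contains exactly one of `x i`, `y i` for each `i`.  Fix `k` and assume
that for every `i` the pair `{x k, y i}` is a vertex cover (meets every edge).
Then `y k` is a free vertex: the only edge containing `y k` is `e₂ = range y`. -/
theorem free_vertex (V : Type*) [Fintype V] (E : Set (Set V)) (d : ℕ) (hd : 0 < d)
    (x y : Fin d → V)
    (hx : Function.Injective x) (hy : Function.Injective y)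
    (hdisj : Disjoint (Set.range x) (Set.range y))
    (hunion : Set.range x ∪ Set.range y = Set.univ)
    (he1 : Set.range x ∈ E) (he2 : Set.range y ∈ E)
    (hexact : ∀ e ∈ E, ∀ i : Fin d, (x i ∈ e ∧ y i ∉ e) ∨ (x i ∉ e ∧ y i ∈ e))
    (k : Fin d)
    (hcov : ∀ i : Fin d, ∀ e ∈ E, x k ∈ e ∨ y i ∈ e) :
    ∀ e ∈ E, y k ∈ e → e = Set.range y := by
  intro e he hyk
  have hxk : x k ∉ e := by
    rcases hexact e he k with h | h
    · exact absurd hyk h.2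
    · exact h.1
  have hye : ∀ i, y i ∈ e := fun i => (hcov i e he).resolve_left hxk
  apply Set.Subset.antisymm
  · intro v hv
    have hv' : v ∈ Set.range x ∪ Set.range y := hunion ▸ Set.mem_univ v
    rcases hv' with ⟨i, rfl⟩ | h
    · rcases hexact e he i with h | h
      · exact absurd (hye i) h.2
      · exact absurd hv h.1
    · exact h
  · rintro _ ⟨i, rfl⟩
    exact hye i
end

section
/- Let G be a simple graph on a vertex type V, and let A and B be disjoint sets of vertices with A ∪ B = V such that every edge of G joins a vertex of A to a vertex of B (G is bipartite with parts A and B). Suppose m : A → B is a bijection such that a is adjacent to m(a) in G for every a ∈ A. If v ∈ A is a simplicial vertex of the complement graph Gᶜ, meaning that the neighborhood of v in Gᶜ is a clique of Gᶜ, then v is adjacent in G to every vertex of B. -/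
/-- Key graph-theoretic step in Theorem 3.6: let `G` be a bipartite graph with parts
`A` and `B` (disjoint, covering all vertices, and every edge joining `A` to `B`),
equipped with a bijection `m : A → B` such that `a` is adjacent to `m a` for every
`a ∈ A`.  If `v ∈ A` is a simplicial vertex of the complement graph `Gᶜ` (its
neighborhood in `Gᶜ` is a clique of `Gᶜ`), then `v` is adjacent in `G` to every
vertex of `B`. -/
theorem simplicial_vertex_adjacent_to_all (V : Type*) (G : SimpleGraph V)
    (A B : Set V)
    (hdisj : Disjoint A B) (hunion : A ∪ B = Set.univ)
    (hbip : ∀ u w : V, G.Adj u w → (u ∈ A ∧ w ∈ B) ∨ (u ∈ B ∧ w ∈ A))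
    (m : V → V) (hm : Set.BijOn m A B)
    (hadj : ∀ a ∈ A, G.Adj a (m a))
    (v : V) (hv : v ∈ A)
    (hsimp : ∀ u w : V, Gᶜ.Adj v u → Gᶜ.Adj v w → u ≠ w → Gᶜ.Adj u w) :
    ∀ b ∈ B, G.Adj v b := by
  intro b hb
  obtain ⟨a, ha, rfl⟩ := hm.surjOn hb
  by_contra hvb
  have hva : v ≠ a := by
    rintro rfl
    exact hvb (hadj v hv)
  have hnva : ¬ G.Adj v a := by
    intro h
    rcases hbip v a h with ⟨-, haB⟩ | ⟨hvB, -⟩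
    · exact Set.disjoint_left.mp hdisj ha haB
    · exact Set.disjoint_left.mp hdisj hv hvB
  have hvm : v ≠ m a := by
    intro h
    exact Set.disjoint_left.mp hdisj hv (h ▸ hb)
  have hcompl : Gᶜ.Adj a (m a) :=
    hsimp a (m a) ((G.compl_adj v a).mpr ⟨hva, hnva⟩)
      ((G.compl_adj v (m a)).mpr ⟨hvm, hvb⟩) (hadj a ha).ne
  exact ((G.compl_adj a (m a)).mp hcompl).2 (hadj a ha)
end
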